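/- Lemma 3(ii): Under Assumption 2, for all i, j ∈ V with i ≠ j, ξᵢ > 0 (i partially stubborn or non-stubborn) and ξⱼ < 1 (j stubborn), one has Ψ i j > 0 if and only if there exists m ≥ 1 with ((ΞW)^m) i j > 0; equivalently, if and only if there is a directed path from j to i in G(W) all of whose vertices other than j satisfy ξ > 0 (i.e., are partially stubborn or non-stubborn). -/

import Mathlib

open Matrix Filter Finset

/-- `S` is an independent strongly connected component of the influence graph `G(W)`
(edge from `j` to `i` iff `W i j ≠ 0`): nonempty, in-closed and strongly connected. -/
def IsISCC {n : ℕ} (W : Matrix (Fin n) (Fin n) ℝ) (S : Set (Fin n)) : Prop :=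
  S.Nonempty ∧ (∀ i ∈ S, ∀ j, W i j ≠ 0 → j ∈ S) ∧
    (∀ i ∈ S, ∀ j ∈ S, i ≠ j → ∃ m, 1 ≤ m ∧ 0 < (W ^ m) i j)

/-- Assumption 2: every ISCC of `G(W)` contains at least one stubborn agent. -/
def Assumption2 {n : ℕ} (W : Matrix (Fin n) (Fin n) ℝ) (ξ : Fin n → ℝ) : Prop :=
  ∀ S : Set (Fin n), IsISCC W S → ∃ i ∈ S, ξ i < 1

section NonnegMatrix

variable {n : ℕ} {A W : Matrix (Fin n) (Fin n) ℝ}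

theorem Matrix.pow_apply_nonneg_of_nonneg (hA : ∀ i j, 0 ≤ A i j) (m : ℕ) (i j : Fin n) :
    0 ≤ (A ^ m) i j := by
  induction m generalizing j with
  | zero => rw [pow_zero, Matrix.one_apply]; split_ifs <;> norm_num
  | succ m ih =>
    rw [pow_succ, Matrix.mul_apply]
    exact Finset.sum_nonneg fun k _ => mul_nonneg (ih k) (hA k j)

theorem Matrix.pow_succ_apply_pos (hA : ∀ i j, 0 ≤ A i j) {m : ℕ} {i j k : Fin n}
    (hij : 0 < (A ^ m) i j) (hjk : A j k ≠ 0) : 0 < (A ^ (m + 1)) i k := by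
  rw [pow_succ, Matrix.mul_apply]
  exact Finset.sum_pos'
    (fun l _ => mul_nonneg (Matrix.pow_apply_nonneg_of_nonneg hA m i l) (hA l k))
    ⟨j, Finset.mem_univ j, mul_pos hij ((hA j k).lt_of_ne' hjk)⟩

theorem mem_of_pow_apply_ne_zero {S : Set (Fin n)} (hS : ∀ i ∈ S, ∀ j, W i j ≠ 0 → j ∈ S)
    {i : Fin n} (hi : i ∈ S) {m : ℕ} {j : Fin n} (h : (W ^ m) i j ≠ 0) : j ∈ S := by
  induction m generalizing j with
  | zero =>
    rw [pow_zero, Matrix.one_apply] at h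
    split_ifs at h with hij
    · exact hij ▸ hi
    · exact absurd rfl h
  | succ m ih =>
    rw [pow_succ, Matrix.mul_apply] at h
    obtain ⟨k, -, hk⟩ := Finset.exists_ne_zero_of_sum_ne_zero h
    exact hS k (ih (left_ne_zero_of_mul hk)) j (right_ne_zero_of_mul hk)

/-- Every nonempty in-closed set of agents contains an ISCC. -/
theorem exists_isISCC_subset (hW : ∀ i j, 0 ≤ W i j) {S : Set (Fin n)} (hne : S.Nonempty)
    (hS : ∀ i ∈ S, ∀ j, W i j ≠ 0 → j ∈ S) : ∃ T ⊆ S, IsISCC W T := by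
  obtain ⟨T, hTS, hT⟩ := exists_minimal_le_of_wellFoundedLT
    (fun T : Set (Fin n) => T.Nonempty ∧ ∀ i ∈ T, ∀ j, W i j ≠ 0 → j ∈ T) S ⟨hne, hS⟩
  refine ⟨T, hTS, hT.prop.1, hT.prop.2, fun i hi j hj hij => ?_⟩
  have hR : T ⊆ {k | ∃ m, 0 < (W ^ m) i k} :=
    hT.le_of_le
      ⟨⟨i, 0, by simp⟩, fun k ⟨m, hm⟩ l hl => ⟨m + 1, Matrix.pow_succ_apply_pos hW hm hl⟩⟩
      fun k ⟨_, hm⟩ => mem_of_pow_apply_ne_zero hT.prop.2 hi hm.ne'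
  obtain ⟨m, hm⟩ := hR hj
  refine ⟨m, Nat.one_le_iff_ne_zero.2 ?_, hm⟩
  rintro rfl
  simp [hij] at hm

/-- Maximum principle: under Assumption 2, subharmonic vectors of `ΞW` are nonpositive. -/
theorem Assumption2.nonpos_of_le_mulVec {ξ : Fin n → ℝ} (hA2 : Assumption2 W ξ)
    (hW0 : ∀ i j, 0 ≤ W i j) (hW1 : ∀ i, ∑ j, W i j = 1) (hξ : ∀ i, 0 ≤ ξ i ∧ ξ i ≤ 1)
    {x : Fin n → ℝ} (hx : x ≤ (diagonal ξ * W) *ᵥ x) : x ≤ 0 := by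
  intro i₀
  by_contra! hi₀
  obtain ⟨p, -, hp⟩ := Finset.exists_max_image univ x ⟨i₀, mem_univ i₀⟩
  have hpos : 0 < x p := hi₀.trans_le (hp i₀ (mem_univ i₀))
  have hle : ∀ i, x i ≤ ξ i * ∑ j, W i j * x j := fun i => by
    simpa [mulVec, dotProduct, mul_assoc, Finset.mul_sum] using hx i
  have hsum : ∀ i, ∑ j, W i j * x j ≤ x p := fun i =>
    calc ∑ j, W i j * x j ≤ ∑ j, W i j * x p :=
          sum_le_sum fun j _ => mul_le_mul_of_nonneg_left (hp j (mem_univ j)) (hW0 i j)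
      _ = x p := by rw [← sum_mul, hW1, one_mul]
  have hstub : ∀ i, x i = x p → 1 ≤ ξ i ∧ ∑ j, W i j * x j = x p := fun i hi => by
    have h := hle i
    rw [hi] at h
    have h1 := mul_le_mul_of_nonneg_left (hsum i) (hξ i).1
    have hone : 1 ≤ ξ i := le_of_mul_le_mul_right (by linarith) hpos
    rw [(hξ i).2.antisymm hone, one_mul] at h
    exact ⟨hone, (hsum i).antisymm h⟩
  have hclosed : ∀ i ∈ {i | x i = x p}, ∀ j, W i j ≠ 0 → j ∈ {i | x i = x p} := by
    intro i hi j hij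
    have h0 : ∑ k, W i k * (x p - x k) = 0 := by
      simp only [mul_sub, sum_sub_distrib, ← sum_mul, hW1, (hstub i hi).2, one_mul, sub_self]
    have h := (sum_eq_zero_iff_of_nonneg fun k _ =>
      mul_nonneg (hW0 i k) (sub_nonneg.2 (hp k (mem_univ k)))).1 h0 j (mem_univ j)
    exact (sub_eq_zero.1 ((mul_eq_zero.1 h).resolve_left hij)).symm
  obtain ⟨T, hTS, hT⟩ := exists_isISCC_subset hW0 (S := {i | x i = x p}) ⟨p, rfl⟩ hclosed
  obtain ⟨i, hi, hlt⟩ := hA2 T hT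
  exact hlt.not_ge (hstub i (hTS hi)).1

theorem Matrix.isUnit_one_sub_of_max_principle
    (hmax : ∀ x : Fin n → ℝ, x ≤ A *ᵥ x → x ≤ 0) : IsUnit (1 - A) := by
  refine Matrix.mulVec_injective_iff_isUnit.1 fun x y hxy => ?_
  have hle : ∀ x y : Fin n → ℝ, (1 - A) *ᵥ x = (1 - A) *ᵥ y → x ≤ y := fun x y h => by
    rw [sub_mulVec, sub_mulVec, one_mulVec, one_mulVec] at h
    refine sub_nonpos.1 (hmax (x - y) (le_of_eq ?_))
    rw [mulVec_sub]
    linear_combination h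
  exact (hle x y hxy).antisymm (hle y x hxy.symm)

theorem Matrix.inv_one_sub_eq_of_max_principle
    (hmax : ∀ x : Fin n → ℝ, x ≤ A *ᵥ x → x ≤ 0) :
    (1 - A)⁻¹ = 1 + A * (1 - A)⁻¹ := by
  have h := Matrix.mul_nonsing_inv (1 - A)
    ((Matrix.isUnit_iff_isUnit_det _).1 (isUnit_one_sub_of_max_principle hmax))
  rw [sub_mul, one_mul, sub_eq_iff_eq_add] at h
  exact h

theorem Matrix.inv_one_sub_apply_of_max_principle
    (hmax : ∀ x : Fin n → ℝ, x ≤ A *ᵥ x → x ≤ 0) (i j : Fin n) :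
    (1 - A)⁻¹ i j = (1 : Matrix (Fin n) (Fin n) ℝ) i j + ∑ k, A i k * (1 - A)⁻¹ k j := by
  conv_lhs => rw [inv_one_sub_eq_of_max_principle hmax]
  rw [add_apply, mul_apply]

theorem Matrix.inv_one_sub_nonneg_of_max_principle
    (hmax : ∀ x : Fin n → ℝ, x ≤ A *ᵥ x → x ≤ 0) (i j : Fin n) :
    0 ≤ (1 - A)⁻¹ i j := by
  refine neg_nonpos.1 (hmax (fun i => -(1 - A)⁻¹ i j) (fun k => ?_) i)
  have h1 : 0 ≤ (1 : Matrix (Fin n) (Fin n) ℝ) k j := by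
    rw [one_apply]; split_ifs <;> norm_num
  simp only [mulVec, dotProduct, mul_neg, sum_neg_distrib]
  linarith [inv_one_sub_apply_of_max_principle hmax k j]

theorem Matrix.inv_one_sub_apply_pos_iff_of_max_principle
    (hmax : ∀ x : Fin n → ℝ, x ≤ A *ᵥ x → x ≤ 0) (hA : ∀ i j, 0 ≤ A i j) (i j : Fin n) :
    0 < (1 - A)⁻¹ i j ↔ ∃ m, 0 < (A ^ m) i j := by
  have hB := inv_one_sub_apply_of_max_principle hmax
  have hB0 := inv_one_sub_nonneg_of_max_principle hmax
  constructor
  · contrapose!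
    intro h
    let R : Set (Fin n) := {k | ∃ m, 0 < (A ^ m) i k}
    have hj : j ∉ R := fun ⟨m, hm⟩ => (h m).not_gt hm
    have hi : i ∈ R := ⟨0, by simp⟩
    have hx : ∀ k, 0 ≤ R.indicator (fun k => (1 - A)⁻¹ k j) k :=
      Set.indicator_nonneg fun k _ => hB0 k j
    have hle := hmax (R.indicator fun k => (1 - A)⁻¹ k j) fun k => by
      by_cases hk : k ∈ R
      · obtain ⟨m, hm⟩ := id hk
        have hkj : k ≠ j := fun h => hj (h ▸ hk)
        rw [Set.indicator_of_mem hk, hB, one_apply_ne hkj, zero_add]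
        refine sum_le_sum fun l _ => le_of_eq ?_
        by_cases hkl : A k l = 0
        · simp [hkl]
        · rw [Set.indicator_of_mem (show l ∈ R from ⟨m + 1, pow_succ_apply_pos hA hm hkl⟩)]
      · rw [Set.indicator_of_notMem hk]
        exact dotProduct_nonneg_of_nonneg (hA k) hx
    simpa [Set.indicator_of_mem hi] using hle i
  · rintro ⟨m, hm⟩
    induction m generalizing i with
    | zero =>
      rw [hB]
      exact add_pos_of_pos_of_nonneg (by simpa using hm)
        (sum_nonneg fun k _ => mul_nonneg (hA i k) (hB0 k j))
    | succ m ih =>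
      rw [pow_succ', mul_apply] at hm
      obtain ⟨k, -, hk⟩ := exists_ne_zero_of_sum_ne_zero hm.ne'
      have hAk := (hA i k).lt_of_ne' (left_ne_zero_of_mul hk)
      have hmk := (pow_apply_nonneg_of_nonneg hA m k j).lt_of_ne' (right_ne_zero_of_mul hk)
      rw [hB]
      refine add_pos_of_nonneg_of_pos (by rw [one_apply]; split_ifs <;> norm_num) ?_
      exact sum_pos' (fun k _ => mul_nonneg (hA i k) (hB0 k j))
        ⟨k, mem_univ k, mul_pos hAk (ih k hmk)⟩

end NonnegMatrix

/-- Lemma 3(ii): under Assumption 2, for `i ≠ j` with `ξ i > 0` and `ξ j < 1`,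
`Ψ i j > 0` iff there is a directed path from `j` to `i` through agents with
positive susceptibility, i.e. iff `((ΞW)^m) i j > 0` for some `m ≥ 1`. -/
theorem psi_entry_pos_iff_path
    (n : ℕ) (hn : 1 ≤ n)
    (W Ξ : Matrix (Fin n) (Fin n) ℝ) (ξ : Fin n → ℝ)
    (hW0 : ∀ i j, 0 ≤ W i j) (hW1 : ∀ i, ∑ j, W i j = 1)
    (hΞ : Ξ = Matrix.diagonal ξ) (hξ : ∀ i, 0 ≤ ξ i ∧ ξ i ≤ 1)
    (hA2 : Assumption2 W ξ)
    (Ψ : Matrix (Fin n) (Fin n) ℝ) (hΨ : Ψ = (1 - Ξ * W)⁻¹ * (1 - Ξ)) :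
    ∀ i j, i ≠ j → 0 < ξ i → ξ j < 1 →
      (0 < Ψ i j ↔ ∃ m, 1 ≤ m ∧ 0 < ((Ξ * W) ^ m) i j) := by
  intro i j hij _ hj
  subst hΞ hΨ
  have hA : ∀ i j, 0 ≤ (diagonal ξ * W) i j := fun i j => by
    rw [diagonal_mul]
    exact mul_nonneg (hξ i).1 (hW0 i j)
  have hone : (1 : Matrix (Fin n) (Fin n) ℝ) - diagonal ξ = diagonal fun k => 1 - ξ k := by
    rw [← diagonal_one, diagonal_sub]
  rw [hone, mul_diagonal, mul_pos_iff_of_pos_right (sub_pos.2 hj),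
    inv_one_sub_apply_pos_iff_of_max_principle
      (fun _ hx => hA2.nonpos_of_le_mulVec hW0 hW1 hξ hx) hA]
  refine ⟨fun ⟨m, hm⟩ => ⟨m, Nat.one_le_iff_ne_zero.2 ?_, hm⟩, fun ⟨m, _, hm⟩ => ⟨m, hm⟩⟩
  rintro rfl
  simp [hij] at hm
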